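/- Let M be a fixed n×n complex matrix, let c ≥ 0, and let v be a random vector in ℂⁿ (with finitely many values, or more generally such that vv* is integrable) satisfying E[vv*] = c·Iₙ. Then for every x ∈ ℂ, E[det(xI − M − vv*)] = det(xI − M) − c·(d/dx) det(xI − M); i.e., the expected characteristic polynomial of M + vv* equals (1 − c·d/dx) applied to the characteristic polynomial of M. -/

import Mathlib

noncomputable section

/-- The rank-one outer product `v v*` of a vector `v ∈ ℂⁿ`, as an n×n matrix. -/
def outer {n : ℕ} (v : EuclideanSpace ℂ (Fin n)) : Matrix (Fin n) (Fin n) ℂ :=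
  Matrix.of fun i j => v i * (starRingEnd ℂ) (v j)

/-- Jacobi's formula at a point where `x • 1 - M` is invertible. -/
theorem eval_derivative_charpoly_of_isUnit_det {n K : Type*} [Fintype n] [DecidableEq n] [Field K]
    [Infinite K] (M : Matrix n n K) (x : K) (hx : IsUnit (x • (1 : Matrix n n K) - M).det) :
    M.charpoly.derivative.eval x
      = (x • (1 : Matrix n n K) - M).det * (x • (1 : Matrix n n K) - M)⁻¹.trace := by
  set A := x • (1 : Matrix n n K) - M with hA
  have key : M.charpoly.comp (Polynomial.C x + Polynomial.X)
      = Polynomial.C A.det *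
        (1 + (Polynomial.X : Polynomial K) • A⁻¹.map Polynomial.C).det := by
    refine Polynomial.funext fun t => ?_
    have h : (1 + (Polynomial.X : Polynomial K) • A⁻¹.map Polynomial.C).map (Polynomial.evalRingHom t)
        = 1 + t • A⁻¹ := by
      ext i j
      by_cases hij : i = j <;> simp [hij] <;> ring
    rw [Polynomial.eval_comp, Matrix.eval_charpoly, Polynomial.eval_mul, Polynomial.eval_C,
      ← Polynomial.coe_evalRingHom t, RingHom.map_det, RingHom.mapMatrix_apply, h,
      ← Matrix.det_mul, mul_add, mul_one, mul_smul_comm, Matrix.mul_nonsing_inv _ hx, hA]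
    congr 1
    ext i j
    by_cases hij : i = j <;> simp [hij]
    ring
  have := congrArg (fun q => (Polynomial.derivative q).eval 0) key
  simpa [Polynomial.derivative_comp, Matrix.derivative_det_one_add_X_smul] using this

/-- The determinant of a rank-one downdate of an invertible matrix. -/
theorem det_sub_outer {n : ℕ} (A : Matrix (Fin n) (Fin n) ℂ) (hA : IsUnit A.det)
    (v : EuclideanSpace ℂ (Fin n)) :
    (A - outer v).det = A.det - A.det * (A⁻¹ * outer v).trace := by
  have h : outer v = Matrix.replicateCol Unit v.ofLp * Matrix.replicateRow Unit (star v.ofLp) := by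
    ext i j
    simp [outer, Matrix.mul_apply]
  have h' : A - outer v
      = A * (1 - A⁻¹ * Matrix.replicateCol Unit v.ofLp * Matrix.replicateRow Unit (star v.ofLp)) := by
    rw [mul_sub, mul_one, Matrix.mul_assoc, Matrix.mul_nonsing_inv_cancel_left _ _ hA, h]
  rw [h', Matrix.det_mul, Matrix.det_one_sub_mul_comm, h, ← Matrix.mul_assoc A⁻¹,
    Matrix.trace_mul_comm (A⁻¹ * _)]
  simp [Matrix.trace, mul_sub]

/-- Let `M` be a fixed n×n complex matrix, `c ≥ 0`, and let `v` be
a random vector in ℂⁿ taking finitely many values (outcome `w i` with probability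
`p i`, over a finite outcome type `ι`) such that `E[vv*] = c·Iₙ`. Then for every
`x ∈ ℂ`,
`E[det(xI − M − vv*)] = det(xI − M) − c·(d/dx) det(xI − M)`,
the derivative of the characteristic polynomial `det(xI − M) = charpoly M` being
taken as a polynomial in `x`. -/
theorem expected_charpoly_rank_one_update
    {n : ℕ} (M : Matrix (Fin n) (Fin n) ℂ) (c : ℝ) (hc : 0 ≤ c)
    {ι : Type} [Fintype ι] (p : ι → ℝ) (hp : ∀ i, 0 ≤ p i) (hp1 : (∑ i, p i) = 1)
    (w : ι → EuclideanSpace ℂ (Fin n))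
    (hE : (∑ i, (p i : ℂ) • outer (w i)) = (c : ℂ) • (1 : Matrix (Fin n) (Fin n) ℂ))
    (x : ℂ) :
    (∑ i, (p i : ℂ) * Matrix.det (x • (1 : Matrix (Fin n) (Fin n) ℂ) - M - outer (w i)))
      = Matrix.det (x • (1 : Matrix (Fin n) (Fin n) ℂ) - M)
        - (c : ℂ) * Polynomial.eval x (Polynomial.derivative (Matrix.charpoly M)) := by
  have hcont : ∀ B : Matrix (Fin n) (Fin n) ℂ,
      Continuous fun y : ℂ => (y • (1 : Matrix (Fin n) (Fin n) ℂ) - B).det := fun B =>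
    Continuous.matrix_det (by fun_prop)
  have hdense : Dense {y : ℂ | M.charpoly.IsRoot y}ᶜ :=
    (Polynomial.finite_setOfPred_isRoot M.charpoly_monic.ne_zero).countable.dense_compl ℂ
  refine congrFun (Continuous.ext_on (f := fun y : ℂ =>
      ∑ i, (p i : ℂ) * Matrix.det (y • (1 : Matrix (Fin n) (Fin n) ℂ) - M - outer (w i)))
    (g := fun y : ℂ => Matrix.det (y • (1 : Matrix (Fin n) (Fin n) ℂ) - M)
        - (c : ℂ) * Polynomial.eval y (Polynomial.derivative (Matrix.charpoly M)))
    hdense ?_ ?_ fun y hy => ?_) x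
  · simp only [sub_sub]
    exact continuous_finsetSum _ fun i _ => continuous_const.mul (hcont _)
  · exact (hcont M).sub (continuous_const.mul (Polynomial.continuous _))
  · have hu : IsUnit (y • (1 : Matrix (Fin n) (Fin n) ℂ) - M).det := by
      rw [isUnit_iff_ne_zero, Matrix.smul_one_eq_diagonal]
      simpa [Polynomial.IsRoot, Matrix.eval_charpoly, Matrix.scalar_apply] using hy
    have hsum : ∑ i, (p i : ℂ) = 1 := by exact_mod_cast hp1
    have htr : ∀ B : Matrix (Fin n) (Fin n) ℂ,
        ∑ i, (p i : ℂ) * (B * outer (w i)).trace = c * B.trace := fun B => by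
      have := congrArg (fun N => (B * N).trace) hE
      simpa [Finset.mul_sum, Matrix.trace_sum] using this
    simp only [det_sub_outer _ hu, eval_derivative_charpoly_of_isUnit_det M y hu, mul_sub,
      Finset.sum_sub_distrib, ← Finset.sum_mul, hsum, one_mul, mul_left_comm (_ : ℂ)
      (y • (1 : Matrix (Fin n) (Fin n) ℂ) - M).det, ← Finset.mul_sum, htr]

end
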